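/- arXiv:1207.6983 — 3 statements merged into one kernel-verified Lean document; each statement's English description precedes it below -/
import Mathlib

section
/- Let d < 0 be a negative fundamental discriminant whose factorization into pairwise coprime prime discriminants d = q_1*·…·q_t* has q_1* = 8 and q_2*, …, q_t* odd, numbered so that q_i* > 0 for 1 ≤ i ≤ u and q_i* < 0 for u < i ≤ t, where 1 ≤ u ≤ t−1. In ℂ set α_i = (1 + √q_i*)/2 and ᾱ_i = (1 − √q_i*)/2 for i ≥ 2, and let K_G = ℚ(√q_1*, …, √q_t*) ⊂ ℂ with ring of integers 𝓞. For s ∈ {0,1}^{t−1} define β_s = (√2)^{s_1} · (∏_{i=2}^{u} ᾱ_i^{s_i}·α_i^{1−s_i}) · ( (∏_{i=u+1}^{t−1} ᾱ_i^{s_i}·α_i^{1−s_i})·α_t + (∏_{i=u+1}^{t−1} ᾱ_i^{1−s_i}·α_i^{s_i})·ᾱ_t ) and β*_s = (√2)^{1−s_1} · (∏_{i=2}^{u} (−ᾱ_i)^{s_i}·α_i^{1−s_i}) · ( (∏_{i=u+1}^{t−1} (−ᾱ_i)^{s_i}·α_i^{1−s_i})·α_t − (∏_{i=u+1}^{t−1}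 ᾱ_i^{1−s_i}·(−α_i)^{s_i})·ᾱ_t ). Then: (1) the numbers β_s form a ℤ-basis of 𝓞 ∩ ℝ; (2) the numbers β*_s form a ℤ-basis of the ℤ-module 𝓞 ∩ iℝ; (3) if for each μ ∈ {0,1}^{t−1}, τ_μ is a ℚ-algebra automorphism of K_G with τ_μ(√q_i*) = (−1)^{μ_i}·√q_i* for 1 ≤ i ≤ t−1 and τ_μ(√q_t*) = √q_t*, then for all η, ν ∈ {0,1}^{t−1}, ∑_{μ} (−1)^{μ_1+…+μ_{t−1}} τ_μ(β_η·β*_ν) equals √q_1*·…·√q_t* if η = ν and 0 otherwise. -/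
/-- The square root of a real number inside `ℂ`: for a negative real `x`,
`√x` denotes `i·√|x|`. -/
noncomputable def csqrt (x : ℝ) : ℂ :=
  if x < 0 then Complex.I * Real.sqrt (-x) else Real.sqrt x

/-- A negative fundamental discriminant. -/
def IsNegFundamentalDiscriminant (d : ℤ) : Prop :=
  d < 0 ∧ ((d % 4 = 1 ∧ Squarefree d) ∨
    (d % 4 = 0 ∧ Squarefree (d / 4) ∧ d / 4 % 4 ≠ 1))

/-- A prime discriminant. -/
def IsPrimeDiscriminant (q : ℤ) : Prop :=
  (∃ p : ℕ, p.Prime ∧ Odd p ∧ q = (-1) ^ ((p - 1) / 2) * (p : ℤ)) ∨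
    q = -4 ∨ q = 8 ∨ q = -8

/-- A family `e` of complex numbers is a `ℤ`-basis of `𝓞 ∩ ℝ`. -/
def IsIntBasisReal {ι : Type*} (M : IntermediateField ℚ ℂ) (e : ι → ℂ) : Prop :=
  (∀ s, e s ∈ M) ∧ (∀ s, IsIntegral ℤ (e s)) ∧ (∀ s, (e s).im = 0) ∧
    LinearIndependent ℤ e ∧
    ∀ x : ℂ, x ∈ M → IsIntegral ℤ x → x.im = 0 → x ∈ Submodule.span ℤ (Set.range e)

/-- A family `e` of complex numbers is a `ℤ`-basis of the `ℤ`-module `𝓞 ∩ iℝ`. -/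
def IsIntBasisImag {ι : Type*} (M : IntermediateField ℚ ℂ) (e : ι → ℂ) : Prop :=
  (∀ s, e s ∈ M) ∧ (∀ s, IsIntegral ℤ (e s)) ∧ (∀ s, (e s).re = 0) ∧
    LinearIndependent ℤ e ∧
    ∀ x : ℂ, x ∈ M → IsIntegral ℤ x → x.re = 0 → x ∈ Submodule.span ℤ (Set.range e)

/-- If no product of a nonempty subfamily of the square roots `w i` lies in the base field of a
Galois extension, then every choice of signs is realised by an automorphism. -/
theorem exists_algEquiv_neg_one_pow_mul {F E ι : Type*} [Field F] [Field E] [Algebra F E]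
    [IsGalois F E] [Fintype ι] (w : ι → E) (hw : ∀ i, ∃ q : F, w i ^ 2 = algebraMap F E q)
    (hind : ∀ S : Finset ι, S.Nonempty → ∏ i ∈ S, w i ∉ Set.range (algebraMap F E))
    (ε : ι → Fin 2) : ∃ σ : E ≃ₐ[F] E, ∀ i, σ (w i) = (-1) ^ (ε i : ℕ) * w i := by
  classical
  have hpow : ∀ a b : ZMod 2, (-1 : E) ^ (a + b).val = (-1) ^ a.val * (-1) ^ b.val := by
    intro a b
    rw [ZMod.val_add, ← neg_one_pow_eq_pow_mod_two, pow_add]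
  let P : AddSubgroup (ι → ZMod 2) :=
    { carrier := {v | ∃ σ : E ≃ₐ[F] E, ∀ i, σ (w i) = (-1) ^ (v i).val * w i}
      zero_mem' := ⟨AlgEquiv.refl, by simp⟩
      add_mem' := by
        rintro v v' ⟨σ, hσ⟩ ⟨σ', hσ'⟩
        refine ⟨σ.trans σ', fun i => ?_⟩
        simp [hσ, hσ', hpow, mul_assoc]
      neg_mem' := by
        rintro v ⟨σ, hσ⟩
        exact ⟨σ, fun i => by simp [hσ, ZMod.neg_eq_self_mod_two]⟩ }
  by_cases hP : AddSubgroup.toZModSubmodule 2 P = ⊤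
  · have hmem : (fun i => ((ε i : ℕ) : ZMod 2)) ∈ AddSubgroup.toZModSubmodule 2 P := by
      rw [hP]; trivial
    obtain ⟨σ, hσ⟩ := hmem
    refine ⟨σ, fun i => ?_⟩
    rw [hσ, ZMod.val_natCast, Nat.mod_eq_of_lt (ε i).2]
  · exfalso
    obtain ⟨f, hf, hPf⟩ := Submodule.exists_le_ker_of_lt_top _ (lt_top_iff_ne_top.2 hP)
    let S : Finset ι := Finset.univ.filter fun i => f (Pi.single i 1) = 1
    have hfS : ∀ v, f v = ∑ i ∈ S, v i := by
      intro v
      rw [LinearMap.pi_apply_eq_sum_univ, Finset.sum_filter]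
      refine Finset.sum_congr rfl fun i _ => ?_
      generalize hb : f (Pi.single i 1) = b
      have hb' : f (fun j => if i = j then 1 else 0) = b := by
        rw [← hb]; congr 1; ext j; simp [Pi.single_apply, eq_comm]
      rw [hb']
      have hcases : ∀ x : ZMod 2, x = 0 ∨ x = 1 := by decide
      rcases hcases b with rfl | rfl <;> simp
    have hS : S.Nonempty := by
      rw [Finset.nonempty_iff_ne_empty]
      intro hS
      exact hf (LinearMap.ext fun v => by rw [hfS, hS]; simp)
    refine hind S hS ?_
    rw [InfiniteGalois.mem_range_algebraMap_iff_fixed]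
    intro σ
    have hsign : ∀ i, ∃ b : ZMod 2, σ (w i) = (-1) ^ b.val * w i := by
      intro i
      obtain ⟨q, hq⟩ := hw i
      have h2 : σ (w i) ^ 2 = w i ^ 2 := by rw [← map_pow, hq, AlgEquiv.commutes]
      rcases sq_eq_sq_iff_eq_or_eq_neg.1 h2 with h | h
      · exact ⟨0, by simp [h]⟩
      · exact ⟨1, by simp [h, ZMod.val_one]⟩
    choose v hv using hsign
    have hker : f v = 0 := hPf (show v ∈ AddSubgroup.toZModSubmodule 2 P from ⟨σ, hv⟩)
    have heven : Even (∑ i ∈ S, (v i).val) := by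
      rw [← ZMod.natCast_eq_zero_iff_even, Nat.cast_sum, ← hker, hfS]
      exact Finset.sum_congr rfl fun i _ => ZMod.natCast_zmod_val _
    rw [map_prod, Finset.prod_congr rfl fun i _ => hv i, Finset.prod_mul_distrib,
      Finset.prod_pow_eq_pow_sum, heven.neg_one_pow, one_mul]

/-- A field generated by square roots of elements of the base field is Galois. -/
theorem isGalois_adjoin_range_of_sq {F E ι : Type*} [Field F] [CharZero F] [Field E] [Algebra F E]
    [Fintype ι] (w : ι → E) (q : ι → F) (hw : ∀ i, w i ^ 2 = algebraMap F E (q i)) :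
    IsGalois F (IntermediateField.adjoin F (Set.range w)) := by
  open Polynomial in
  set K := IntermediateField.adjoin F (Set.range w)
  have hmem : ∀ i, w i ∈ K := fun i => IntermediateField.subset_adjoin _ _ ⟨i, rfl⟩
  let p : F[X] := ∏ i, (X ^ 2 - C (q i))
  have hp0 : p ≠ 0 := Finset.prod_ne_zero_iff.2 fun i _ => X_pow_sub_C_ne_zero two_pos _
  have hp : p.IsSplittingField F K := by
    rw [IntermediateField.isSplittingField_iff]
    constructor
    · rw [Polynomial.map_prod]
      refine Splits.prod fun i _ => ?_
      have hfac : (X ^ 2 - C (q i)).map (algebraMap F K) =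
          (X - C (⟨w i, hmem i⟩ : K)) * (X + C (⟨w i, hmem i⟩ : K)) := by
        have h2 : (⟨w i, hmem i⟩ : K) ^ 2 = algebraMap F K (q i) := Subtype.ext (hw i)
        rw [Polynomial.map_sub, Polynomial.map_pow, map_X, map_C, ← h2, C_pow]
        ring
      rw [hfac]
      exact (Splits.X_sub_C _).mul (Splits.X_add_C _)
    · refine le_antisymm (IntermediateField.adjoin_le_iff.2 ?_)
        (IntermediateField.adjoin_le_iff.2 ?_)
      · rintro _ ⟨i, rfl⟩
        refine IntermediateField.subset_adjoin _ _ ?_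
        rw [mem_rootSet]
        refine ⟨hp0, ?_⟩
        rw [map_prod]
        exact Finset.prod_eq_zero (Finset.mem_univ i) (by simp [hw])
      · intro x hx
        rw [mem_rootSet, map_prod, Finset.prod_eq_zero_iff] at hx
        obtain ⟨-, i, -, hi⟩ := hx
        have h2 : x ^ 2 = w i ^ 2 := by
          rw [hw]; simpa [sub_eq_zero] using hi
        rcases sq_eq_sq_iff_eq_or_eq_neg.1 h2 with h | h
        · exact h ▸ hmem i
        · exact h ▸ neg_mem (hmem i)
  have := Normal.of_isSplittingField (F := F) (E := K) p
  constructor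

theorem Rat.exists_int_eq_of_sq_mul_squarefree {r : ℚ} {q m : ℤ} (hq : Squarefree q)
    (h : r ^ 2 * q = m) : ∃ k : ℤ, r = k := by
  have hd : (r.den : ℚ) ≠ 0 := by exact_mod_cast r.den_ne_zero
  have h1 : r.num ^ 2 * q = m * (r.den : ℤ) ^ 2 := by
    have : (r.num : ℚ) ^ 2 * q = m * (r.den : ℚ) ^ 2 := by
      rw [← h]
      nth_rewrite 2 [← Rat.num_div_den r]
      field_simp
    exact_mod_cast this
  have hc : IsCoprime ((r.den : ℤ) ^ 2) (r.num ^ 2) := (Rat.isCoprime_num_den r).symm.pow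
  have h2 : (r.den : ℤ) * r.den ∣ q := by
    rw [← sq]
    exact hc.dvd_of_dvd_mul_left ⟨m, by rw [h1, mul_comm]⟩
  have h3 : r.den = 1 := by
    have := Int.isUnit_iff.1 (hq _ h2)
    omega
  exact ⟨r.num, ((Rat.den_eq_one_iff r).1 h3).symm⟩

theorem IsIntegral.exists_int_eq_of_rat {K : Type*} [Field K] [Algebra ℚ K] {r : ℚ}
    (h : IsIntegral ℤ (algebraMap ℚ K r)) : ∃ m : ℤ, r = m := by
  have h' : IsIntegral ℤ r := (isIntegral_algebraMap_iff (algebraMap ℚ K).injective).1 h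
  obtain ⟨m, hm⟩ := IsIntegrallyClosed.isIntegral_iff.1 h'
  exact ⟨m, by simpa using hm.symm⟩

theorem neg_one_pow_sum_add {R : Type*} [CommRing R] {n : ℕ} (μ ν : Fin n → Fin 2) :
    (-1 : R) ^ (∑ i, ((ν + μ) i : ℕ)) = (-1) ^ (∑ i, (ν i : ℕ)) * (-1) ^ (∑ i, (μ i : ℕ)) := by
  simp only [← Finset.prod_pow_eq_pow_sum, ← Finset.prod_mul_distrib, ← pow_add]
  refine Finset.prod_congr rfl fun i _ => ?_
  rw [Pi.add_apply, Fin.val_add, ← neg_one_pow_eq_pow_mod_two]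

section

variable {K : Type*} [Field K] [Algebra ℚ K] {n : ℕ} {w : Fin (n + 1) → K}
  {Q : Fin (n + 1) → ℤ} {τ : (Fin n → Fin 2) → K ≃ₐ[ℚ] K} {c : K ≃ₐ[ℚ] K}

theorem exists_eq_of_apply_last_eq (hw : ∀ i, w i ^ 2 = Q i)
    (hext : ∀ σ σ' : K ≃ₐ[ℚ] K, (∀ i, σ (w i) = σ' (w i)) → σ = σ')
    (hτ : ∀ μ i, τ μ (w i.castSucc) = (-1) ^ (μ i : ℕ) * w i.castSucc)
    (hτl : ∀ μ, τ μ (w (Fin.last n)) = w (Fin.last n))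
    (σ : K ≃ₐ[ℚ] K) (hσ : σ (w (Fin.last n)) = w (Fin.last n)) : ∃ ν, σ = τ ν := by
  have h : ∀ i : Fin n, ∃ b : Fin 2, σ (w i.castSucc) = (-1) ^ (b : ℕ) * w i.castSucc := by
    intro i
    have h2 : σ (w i.castSucc) ^ 2 = w i.castSucc ^ 2 := by rw [← map_pow, hw, map_intCast]
    rcases sq_eq_sq_iff_eq_or_eq_neg.1 h2 with h | h
    · exact ⟨0, by simp [h]⟩
    · exact ⟨1, by simp [h]⟩
  choose ν hν using h
  refine ⟨ν, hext _ _ fun i => ?_⟩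
  induction i using Fin.lastCases with
  | last => rw [hσ, hτl]
  | cast i => rw [hν, hτ]

theorem mem_range_algebraMap_of_fixed [IsGalois ℚ K] (hw : ∀ i, w i ^ 2 = Q i)
    (hext : ∀ σ σ' : K ≃ₐ[ℚ] K, (∀ i, σ (w i) = σ' (w i)) → σ = σ')
    (hτ : ∀ μ i, τ μ (w i.castSucc) = (-1) ^ (μ i : ℕ) * w i.castSucc)
    (hτl : ∀ μ, τ μ (w (Fin.last n)) = w (Fin.last n))
    (hcl : c (w (Fin.last n)) = -w (Fin.last n))
    {x : K} (hx : ∀ ν, τ ν x = x) (hcx : c x = x) : ∃ r : ℚ, algebraMap ℚ K r = x := by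
  change x ∈ Set.range _
  rw [InfiniteGalois.mem_range_algebraMap_iff_fixed]
  intro σ
  have h2 : σ (w (Fin.last n)) ^ 2 = w (Fin.last n) ^ 2 := by rw [← map_pow, hw, map_intCast]
  rcases sq_eq_sq_iff_eq_or_eq_neg.1 h2 with h | h
  · obtain ⟨ν, rfl⟩ := exists_eq_of_apply_last_eq hw hext hτ hτl σ h
    exact hx ν
  · obtain ⟨ν, hν⟩ := exists_eq_of_apply_last_eq hw hext hτ hτl (σ.trans c) (by simp [h, hcl])
    apply c.injective
    rw [hcx]
    exact (DFunLike.congr_fun hν x).trans (hx ν)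

theorem apply_apply_eq_apply_add (hext : ∀ σ σ' : K ≃ₐ[ℚ] K, (∀ i, σ (w i) = σ' (w i)) → σ = σ')
    (hτ : ∀ μ i, τ μ (w i.castSucc) = (-1) ^ (μ i : ℕ) * w i.castSucc)
    (hτl : ∀ μ, τ μ (w (Fin.last n)) = w (Fin.last n)) (μ ν : Fin n → Fin 2) (x : K) :
    τ ν (τ μ x) = τ (ν + μ) x := by
  have h : (τ μ).trans (τ ν) = τ (ν + μ) := by
    refine hext _ _ fun i => ?_
    induction i using Fin.lastCases with
    | last => simp [hτl]
    | cast i =>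
      rw [AlgEquiv.trans_apply, hτ, map_mul, map_pow, map_neg, map_one, hτ, hτ, Pi.add_apply,
        Fin.val_add, ← neg_one_pow_eq_pow_mod_two, pow_add]
      ring
  exact DFunLike.congr_fun h x

/-- For an algebraic integer `y` negated by the complex conjugation `c`, the sum of the conjugates
`τ μ y` twisted by the sign character is an integral multiple of `√q_1* ⋯ √q_t*`. -/
theorem exists_int_twisted_sum_eq_mul_prod [IsGalois ℚ K] (hw : ∀ i, w i ^ 2 = Q i)
    (hext : ∀ σ σ' : K ≃ₐ[ℚ] K, (∀ i, σ (w i) = σ' (w i)) → σ = σ')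
    (hτ : ∀ μ i, τ μ (w i.castSucc) = (-1) ^ (μ i : ℕ) * w i.castSucc)
    (hτl : ∀ μ, τ μ (w (Fin.last n)) = w (Fin.last n))
    (hc : ∀ i, c (w i) = w i ∨ c (w i) = -w i)
    (hcl : c (w (Fin.last n)) = -w (Fin.last n)) (hcw : c (∏ i, w i) = -∏ i, w i)
    {e : ℤ} (he : Squarefree e) (he2 : Even e) (hprod : ∏ i, Q i = 4 * e)
    (hQl : Squarefree (Q (Fin.last n))) (hQl2 : Odd (Q (Fin.last n)))
    {y : K} (hy : IsIntegral ℤ y) (hcy : c y = -y) :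
    ∃ k : ℤ, ∑ μ, (-1) ^ (∑ i, (μ i : ℕ)) * τ μ y = k * ∏ i, w i := by
  have hchar : CharZero K := algebraRat.charZero K
  set D := ∏ i, w i with hD
  set wl := w (Fin.last n) with hwl
  set T := ∑ μ, (-1) ^ (∑ i, (μ i : ℕ)) * τ μ y with hT
  set N := ∑ μ, τ μ y with hN
  have hD2 : D ^ 2 = 4 * e := by
    rw [hD, ← Finset.prod_pow, Finset.prod_congr rfl fun i _ => hw i]
    exact_mod_cast hprod
  have he0 : e ≠ 0 := he.ne_zero
  have hD0 : D ≠ 0 := by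
    intro h
    rw [h] at hD2
    have : (e : K) = 0 := by linear_combination (-1 / 4 : K) * hD2
    exact he0 (by exact_mod_cast this)
  have hwl0 : wl ≠ 0 := by
    intro h
    have := hw (Fin.last n)
    rw [← hwl, h] at this
    exact hQl.ne_zero (by exact_mod_cast (by simpa using this.symm : (Q (Fin.last n) : K) = 0))
  have hcτ : ∀ μ x, c (τ μ x) = τ μ (c x) := by
    intro μ x
    have h : (τ μ).trans c = c.trans (τ μ) := by
      refine hext _ _ fun i => ?_
      rw [AlgEquiv.trans_apply, AlgEquiv.trans_apply]
      have h2 : τ μ (w i) = w i ∨ τ μ (w i) = -w i := by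
        have h2 : τ μ (w i) ^ 2 = w i ^ 2 := by rw [← map_pow, hw, map_intCast]
        exact sq_eq_sq_iff_eq_or_eq_neg.1 h2
      rcases hc i with h | h <;> rcases h2 with h' | h' <;> simp [h, h']
    exact DFunLike.congr_fun h x
  have hτT : ∀ ν, τ ν T = (-1) ^ (∑ i, (ν i : ℕ)) * T := by
    intro ν
    rw [hT, map_sum, Finset.mul_sum]
    refine Fintype.sum_equiv (Equiv.addLeft ν) _ _ fun μ => ?_
    rw [map_mul, map_pow, map_neg, map_one, apply_apply_eq_apply_add hext hτ hτl, Equiv.coe_addLeft,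
      neg_one_pow_sum_add, ← mul_assoc, ← mul_assoc, ← pow_add, Even.neg_one_pow ⟨_, rfl⟩,
      one_mul]
  have hτN : ∀ ν, τ ν N = N := by
    intro ν
    rw [hN, map_sum]
    refine Fintype.sum_equiv (Equiv.addLeft ν) _ _ fun μ => ?_
    rw [apply_apply_eq_apply_add hext hτ hτl, Equiv.coe_addLeft]
  have hτD : ∀ ν, τ ν D = (-1) ^ (∑ i, (ν i : ℕ)) * D := by
    intro ν
    rw [hD, Fin.prod_univ_castSucc, map_mul, hτl, map_prod, Finset.prod_congr rfl fun i _ => hτ ν i,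
      Finset.prod_mul_distrib, Finset.prod_pow_eq_pow_sum, mul_assoc]
  have hcT : c T = -T := by
    rw [hT, map_sum, ← Finset.sum_neg_distrib]
    refine Finset.sum_congr rfl fun μ _ => ?_
    rw [map_mul, map_pow, map_neg, map_one, hcτ, hcy, map_neg, mul_neg]
  have hcN : c N = -N := by
    rw [hN, map_sum, ← Finset.sum_neg_distrib]
    exact Finset.sum_congr rfl fun μ _ => by rw [hcτ, hcy, map_neg]
  obtain ⟨r, hr⟩ := mem_range_algebraMap_of_fixed (x := T / D) hw hext hτ hτl hcl
    (fun ν => by rw [map_div₀, hτT, hτD, mul_div_mul_left _ _ (pow_ne_zero _ (by simp))])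
    (by rw [map_div₀, hcT, hcw, neg_div_neg_eq])
  obtain ⟨s, hs⟩ := mem_range_algebraMap_of_fixed (x := N / wl) hw hext hτ hτl hcl
    (fun ν => by rw [map_div₀, hτN, hτl]) (by rw [map_div₀, hcN, hcl, neg_div_neg_eq])
  rw [eq_div_iff hD0] at hr
  rw [eq_div_iff hwl0] at hs
  have hτint : ∀ μ, IsIntegral ℤ (τ μ y) := fun μ =>
    hy.map ((τ μ : K →ₐ[ℚ] K).restrictScalars ℤ)
  have hTint : IsIntegral ℤ T := IsIntegral.sum _ fun μ _ =>
    ((isIntegral_one.neg).pow _).mul (hτint μ)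
  -- `2 r` is an integer
  have hT2 : T ^ 2 = algebraMap ℚ K (r ^ 2 * (4 * e)) := by
    rw [← hr, mul_pow, hD2]; simp
  obtain ⟨m, hm⟩ := (hT2 ▸ hTint.pow 2).exists_int_eq_of_rat
  obtain ⟨k, hk⟩ := Rat.exists_int_eq_of_sq_mul_squarefree (r := 2 * r) (m := m) he
    (by rw [← hm]; ring)
  obtain ⟨f, hf⟩ := even_iff_two_dvd.1 he2
  have hTk : T ^ 2 = 2 * ((k ^ 2 * f : ℤ) : K) := by
    have : r ^ 2 * (4 * e) = 2 * ((k ^ 2 * f : ℤ) : ℚ) := by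
      push_cast
      rw [← hk, hf]
      push_cast
      ring
    rw [hT2, this]; simp
  -- `N` is congruent to `T` modulo twice the integers
  obtain ⟨W, hWint, hW⟩ : ∃ W, IsIntegral ℤ W ∧ N = T + 2 * W := by
    refine ⟨∑ μ : Fin n → Fin 2, if Even (∑ i, (μ i : ℕ)) then 0 else τ μ y, ?_, ?_⟩
    · refine IsIntegral.sum _ fun μ _ => ?_
      split_ifs
      · exact isIntegral_zero
      · exact hτint μ
    · rw [hN, hT, Finset.mul_sum, ← Finset.sum_add_distrib]
      refine Finset.sum_congr rfl fun μ _ => ?_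
      split_ifs with h
      · rw [h.neg_one_pow]; ring
      · rw [(Nat.not_even_iff_odd.1 h).neg_one_pow]; ring
  have hwl2 : wl ^ 2 = Q (Fin.last n) := hw _
  have hN2 : IsIntegral ℤ (algebraMap ℚ K (s ^ 2 * Q (Fin.last n) / 2)) := by
    have h : algebraMap ℚ K (s ^ 2 * Q (Fin.last n) / 2) =
        ((k ^ 2 * f : ℤ) : K) + 2 * (T * W) + 2 * W ^ 2 := by
      have h1 : N ^ 2 = algebraMap ℚ K (s ^ 2) * Q (Fin.last n) := by
        rw [← hs, mul_pow, hwl2, map_pow]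
      rw [map_div₀, map_mul, map_intCast, ← h1, hW]
      simp only [map_ofNat]
      field_simp
      linear_combination hTk
    rw [h]
    have two : IsIntegral ℤ (2 : K) := by
      simpa using isIntegral_algebraMap (R := ℤ) (A := K) (x := 2)
    exact ((isIntegral_algebraMap (R := ℤ) (x := k ^ 2 * f)).add (two.mul (hTint.mul hWint))).add
      (two.mul (hWint.pow 2))
  obtain ⟨j, hj⟩ := hN2.exists_int_eq_of_rat
  have hj' : s ^ 2 * Q (Fin.last n) = (2 * j : ℤ) := by
    push_cast; linear_combination 2 * hj
  obtain ⟨s', rfl⟩ := Rat.exists_int_eq_of_sq_mul_squarefree hQl hj'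
  have hs'2 : Even s' := by
    have h : s' ^ 2 * Q (Fin.last n) = 2 * j := by exact_mod_cast hj'
    have h2 : Even (s' ^ 2 * Q (Fin.last n)) := ⟨j, by rw [h]; ring⟩
    rcases Int.even_mul.1 h2 with h3 | h3
    · exact (Int.even_pow.1 h3).1
    · exact absurd h3 (Int.not_even_iff_odd.2 hQl2)
  obtain ⟨l, hl⟩ := even_iff_two_dvd.1 hs'2
  have hwlint : IsIntegral ℤ wl := IsIntegral.of_pow two_pos
    (by rw [hwl2]; exact isIntegral_algebraMap (R := ℤ))
  have hTW : T = 2 * (l * wl - W) := by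
    have : N = 2 * l * wl := by rw [← hs, hl]; simp
    linear_combination this - hW
  have hThalf : IsIntegral ℤ (algebraMap ℚ K ((k ^ 2 * f : ℤ) / 2)) := by
    have h : algebraMap ℚ K ((k ^ 2 * f : ℤ) / 2) = (l * wl - W) ^ 2 := by
      rw [map_div₀, map_intCast, map_ofNat]
      have := hTk
      rw [hTW] at this
      field_simp
      linear_combination (-1 / 2 : K) * this
    rw [h]
    exact (((isIntegral_algebraMap (R := ℤ) (x := l)).mul hwlint).sub hWint).pow 2
  obtain ⟨g, hg⟩ := hThalf.exists_int_eq_of_rat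
  have hg' : k ^ 2 * f = 2 * g := by
    have : ((k ^ 2 * f : ℤ) : ℚ) = 2 * g := by linear_combination 2 * hg
    exact_mod_cast this
  have hfodd : ¬ Even f := by
    rintro ⟨f', hf'⟩
    have := Int.isUnit_iff.1 (he 2 ⟨f', by rw [hf, hf']; ring⟩)
    omega
  have hk2 : Even k := by
    rcases Int.even_mul.1 (⟨g, by rw [hg']; ring⟩ : Even (k ^ 2 * f)) with h3 | h3
    · exact (Int.even_pow.1 h3).1
    · exact absurd h3 hfodd
  obtain ⟨k', hk'⟩ := even_iff_two_dvd.1 hk2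
  refine ⟨k', ?_⟩
  have : r = k' := by
    rw [hk'] at hk; push_cast at hk; linarith
  rw [← hr, this]; simp

end

section

variable {R : Type*} [Field R]

/-- The factor of index `i` in the coefficient of `(1 + √q_t*) / 2` in `β_s`, as a function of
the exponent `k` and of the square root `x`. -/
def factor (i k : ℕ) (x : R) : R :=
  if i = 0 then (x / 2) ^ k else ((1 - x) / 2) ^ k * ((1 + x) / 2) ^ (1 - k)

/-- The factor of index `i` in the coefficient of `(1 - √q_t*) / 2` in `β_s`. -/
def factorConj (u i k : ℕ) (x : R) : R :=
  if u ≤ i then ((1 - x) / 2) ^ (1 - k) * ((1 + x) / 2) ^ k else factor i k x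

/-- The factor of index `i` in the coefficient of `(1 + √q_t*) / 2` in `β*_s`. -/
def dualFactor (i k : ℕ) (x : R) : R :=
  if i = 0 then (x / 2) ^ (1 - k) else (-((1 - x) / 2)) ^ k * ((1 + x) / 2) ^ (1 - k)

/-- The factor of index `i` in the coefficient of `-(1 - √q_t*) / 2` in `β*_s`. -/
def dualFactorConj (u i k : ℕ) (x : R) : R :=
  if u ≤ i then ((1 - x) / 2) ^ (1 - k) * (-((1 + x) / 2)) ^ k else dualFactor i k x

/-- The number `β_s` as a function of the square roots. -/
def realBasis {n : ℕ} (u : ℕ) (w : Fin (n + 1) → R) (s : Fin n → Fin 2) : R :=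
  (∏ i : Fin n, factor i (s i) (w i.castSucc)) * ((1 + w (Fin.last n)) / 2) +
    (∏ i : Fin n, factorConj u i (s i) (w i.castSucc)) * ((1 - w (Fin.last n)) / 2)

/-- The number `β*_s` as a function of the square roots. -/
def imagBasis {n : ℕ} (u : ℕ) (w : Fin (n + 1) → R) (s : Fin n → Fin 2) : R :=
  (∏ i : Fin n, dualFactor i (s i) (w i.castSucc)) * ((1 + w (Fin.last n)) / 2) -
    (∏ i : Fin n, dualFactorConj u i (s i) (w i.castSucc)) * ((1 - w (Fin.last n)) / 2)

variable {n : ℕ} {u : ℕ}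

theorem map_factor {S : Type*} [Field S] (σ : R →+* S) (i k : ℕ) (x : R) :
    σ (factor i k x) = factor i k (σ x) := by
  unfold factor; split_ifs <;> simp [map_ofNat σ 2]

theorem map_factorConj {S : Type*} [Field S] (σ : R →+* S) (i k : ℕ) (x : R) :
    σ (factorConj u i k x) = factorConj u i k (σ x) := by
  unfold factorConj; split_ifs <;> simp [map_ofNat σ 2, map_factor]

theorem map_dualFactor {S : Type*} [Field S] (σ : R →+* S) (i k : ℕ) (x : R) :
    σ (dualFactor i k x) = dualFactor i k (σ x) := by
  unfold dualFactor; split_ifs <;> simp [map_ofNat σ 2]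

theorem map_dualFactorConj {S : Type*} [Field S] (σ : R →+* S) (i k : ℕ) (x : R) :
    σ (dualFactorConj u i k x) = dualFactorConj u i k (σ x) := by
  unfold dualFactorConj; split_ifs <;> simp [map_ofNat σ 2, map_dualFactor]

theorem map_realBasis {S : Type*} [Field S] (σ : R →+* S) (w : Fin (n + 1) → R)
    (s : Fin n → Fin 2) : σ (realBasis u w s) = realBasis u (fun i => σ (w i)) s := by
  simp [map_ofNat σ 2, realBasis, map_factor, map_factorConj]

theorem map_imagBasis {S : Type*} [Field S] (σ : R →+* S) (w : Fin (n + 1) → R)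
    (s : Fin n → Fin 2) : σ (imagBasis u w s) = imagBasis u (fun i => σ (w i)) s := by
  simp [map_ofNat σ 2, imagBasis, map_dualFactor, map_dualFactorConj]

theorem realBasis_conj (hu : 1 ≤ u) {w w' : Fin (n + 1) → R}
    (hw : ∀ i : Fin n, w' i.castSucc = if u ≤ (i : ℕ) then -w i.castSucc else w i.castSucc)
    (hwl : w' (Fin.last n) = -w (Fin.last n)) (s : Fin n → Fin 2) :
    realBasis u w' s = realBasis u w s := by
  have h1 : ∀ i : Fin n, factor i (s i) (w' i.castSucc) =
      factorConj u i (s i) (w i.castSucc) := by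
    intro i
    rw [hw]
    by_cases h : u ≤ (i : ℕ)
    · have : (i : ℕ) ≠ 0 := by omega
      simp only [factor, factorConj, h, this, if_true, if_false]
      ring
    · simp only [factorConj, h, if_false]
  have h2 : ∀ i : Fin n, factorConj u i (s i) (w' i.castSucc) =
      factor i (s i) (w i.castSucc) := by
    intro i
    rw [hw]
    by_cases h : u ≤ (i : ℕ)
    · have : (i : ℕ) ≠ 0 := by omega
      simp only [factor, factorConj, h, this, if_true, if_false]
      ring
    · simp only [factorConj, h, if_false]
  simp only [realBasis, h1, h2, hwl]
  ring

theorem imagBasis_conj (hu : 1 ≤ u) {w w' : Fin (n + 1) → R}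
    (hw : ∀ i : Fin n, w' i.castSucc = if u ≤ (i : ℕ) then -w i.castSucc else w i.castSucc)
    (hwl : w' (Fin.last n) = -w (Fin.last n)) (s : Fin n → Fin 2) :
    imagBasis u w' s = -imagBasis u w s := by
  have h1 : ∀ i : Fin n, dualFactor i (s i) (w' i.castSucc) =
      dualFactorConj u i (s i) (w i.castSucc) := by
    intro i
    rw [hw]
    by_cases h : u ≤ (i : ℕ)
    · have : (i : ℕ) ≠ 0 := by omega
      simp only [dualFactor, dualFactorConj, h, this, if_true, if_false]
      ring
    · simp only [dualFactorConj, h, if_false]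
  have h2 : ∀ i : Fin n, dualFactorConj u i (s i) (w' i.castSucc) =
      dualFactor i (s i) (w i.castSucc) := by
    intro i
    rw [hw]
    by_cases h : u ≤ (i : ℕ)
    · have : (i : ℕ) ≠ 0 := by omega
      simp only [dualFactor, dualFactorConj, h, this, if_true, if_false]
      ring
    · simp only [dualFactorConj, h, if_false]
  simp only [imagBasis, h1, h2, hwl]
  ring

theorem sum_neg_one_pow_mul_prod_mul_prod (f g : Fin n → Fin 2 → R) :
    ∑ μ : Fin n → Fin 2, (-1) ^ (∑ i, (μ i : ℕ)) * ((∏ i, f i (μ i)) * ∏ i, g i (μ i)) =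
      ∏ i, ∑ m : Fin 2, (-1) ^ (m : ℕ) * (f i m * g i m) := by
  rw [Fintype.prod_sum]
  refine Finset.sum_congr rfl fun μ _ => ?_
  rw [← Finset.prod_pow_eq_pow_sum, ← Finset.prod_mul_distrib, ← Finset.prod_mul_distrib]

section duality

variable [CharZero R]

theorem sum_factor_mul_dualFactor (i : ℕ) (s s' : Fin 2) (x : R) :
    ∑ m : Fin 2, (-1) ^ (m : ℕ) *
      (factor i s ((-1) ^ (m : ℕ) * x) * dualFactor i s' ((-1) ^ (m : ℕ) * x)) =
        if s = s' then x else 0 := by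
  unfold factor dualFactor
  fin_cases s <;> fin_cases s' <;> split_ifs <;> simp_all <;> ring

theorem sum_factorConj_mul_dualFactorConj (i : ℕ) (s s' : Fin 2) (x : R) :
    ∑ m : Fin 2, (-1) ^ (m : ℕ) *
      (factorConj u i s ((-1) ^ (m : ℕ) * x) * dualFactorConj u i s' ((-1) ^ (m : ℕ) * x)) =
        (if u ≤ i then -1 else 1) * if s = s' then x else 0 := by
  by_cases h : u ≤ i
  · simp only [factorConj, dualFactorConj, h, if_true]
    fin_cases s <;> fin_cases s' <;> simp <;> ring
  · simp only [factorConj, dualFactorConj, h, if_false, sum_factor_mul_dualFactor, one_mul]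

theorem sum_factor_mul_dualFactorConj (hu : 1 ≤ u) (i : ℕ) (s s' : Fin 2) (x : R) :
    ∑ m : Fin 2, (-1) ^ (m : ℕ) *
      (factor i s ((-1) ^ (m : ℕ) * x) * dualFactorConj u i s' ((-1) ^ (m : ℕ) * x)) =
        (if u ≤ i then -1 else 1) * ∑ m : Fin 2, (-1) ^ (m : ℕ) *
      (factorConj u i s ((-1) ^ (m : ℕ) * x) * dualFactor i s' ((-1) ^ (m : ℕ) * x)) := by
  by_cases h : u ≤ i
  · have : i ≠ 0 := by omega
    simp only [factor, dualFactor, factorConj, dualFactorConj, h, this, if_true, if_false]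
    fin_cases s <;> fin_cases s' <;> simp <;> ring
  · simp only [factorConj, dualFactorConj, h, if_false, one_mul]

theorem sum_realBasis_mul_imagBasis (hu : 1 ≤ u)
    (hsign : ∏ i : Fin n, (if u ≤ (i : ℕ) then -1 else 1 : R) = 1)
    (w : Fin (n + 1) → R) (v : (Fin n → Fin 2) → Fin (n + 1) → R)
    (hv : ∀ μ i, v μ (Fin.castSucc i) = (-1) ^ (μ i : ℕ) * w i.castSucc)
    (hvl : ∀ μ, v μ (Fin.last n) = w (Fin.last n)) (η ν : Fin n → Fin 2) :
    ∑ μ, (-1) ^ (∑ i, (μ i : ℕ)) * (realBasis u (v μ) η * imagBasis u (v μ) ν) =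
      if η = ν then ∏ i, w i else 0 := by
  set x := w (Fin.last n)
  have expand : ∀ e A B A' B' p q : R, e * ((A * p + B * q) * (A' * p - B' * q)) =
      e * (A * A') * p ^ 2 - e * (A * B') * (p * q) + e * (B * A') * (p * q) -
        e * (B * B') * q ^ 2 := by
    intros; ring
  simp only [realBasis, imagBasis, hv, hvl, expand, Finset.sum_add_distrib,
    Finset.sum_sub_distrib, ← Finset.sum_mul]
  rw [sum_neg_one_pow_mul_prod_mul_prod
      (fun i m => factor i (η i) ((-1) ^ (m : ℕ) * w i.castSucc))
      (fun i m => dualFactor i (ν i) ((-1) ^ (m : ℕ) * w i.castSucc)),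
    sum_neg_one_pow_mul_prod_mul_prod
      (fun i m => factor i (η i) ((-1) ^ (m : ℕ) * w i.castSucc))
      (fun i m => dualFactorConj u i (ν i) ((-1) ^ (m : ℕ) * w i.castSucc)),
    sum_neg_one_pow_mul_prod_mul_prod
      (fun i m => factorConj u i (η i) ((-1) ^ (m : ℕ) * w i.castSucc))
      (fun i m => dualFactor i (ν i) ((-1) ^ (m : ℕ) * w i.castSucc)),
    sum_neg_one_pow_mul_prod_mul_prod
      (fun i m => factorConj u i (η i) ((-1) ^ (m : ℕ) * w i.castSucc))
      (fun i m => dualFactorConj u i (ν i) ((-1) ^ (m : ℕ) * w i.castSucc))]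
  simp only [sum_factor_mul_dualFactor, sum_factorConj_mul_dualFactorConj,
    sum_factor_mul_dualFactorConj hu]
  rw [Finset.prod_mul_distrib, Finset.prod_mul_distrib, hsign, one_mul, one_mul,
    Fin.prod_univ_castSucc]
  have hδ : ∏ i : Fin n, (if η i = ν i then w i.castSucc else 0) =
      if η = ν then ∏ i : Fin n, w i.castSucc else 0 := by
    split_ifs with h
    · exact Finset.prod_congr rfl fun i _ => by simp [h]
    · obtain ⟨i, hi⟩ := Function.ne_iff.1 h
      exact Finset.prod_eq_zero (Finset.mem_univ i) (if_neg hi)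
  rw [hδ]
  split_ifs <;> ring

end duality

section integrality

variable [CharZero R] {w : Fin (n + 1) → R} {Q : Fin (n + 1) → ℤ}

theorem isIntegral_one_add_div_two {x : R} {q : ℤ} (hx : x ^ 2 = q) (hq : q % 4 = 1) :
    IsIntegral ℤ ((1 + x) / 2) := by
  obtain ⟨m, hm⟩ : ∃ m, q = 4 * m + 1 := ⟨q / 4, by omega⟩
  refine ⟨.X ^ 2 - (.X + .C m), ?_, ?_⟩
  · refine Polynomial.monic_X_pow_sub ?_
    exact (Polynomial.degree_X_add_C m).trans_lt (by norm_num)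
  · have : x ^ 2 = 4 * m + 1 := by rw [hx, hm]; simp
    rw [Polynomial.eval₂_sub, Polynomial.eval₂_add, Polynomial.eval₂_X_pow, Polynomial.eval₂_X,
      Polynomial.eval₂_C, eq_intCast]
    linear_combination this / 4

theorem isIntegral_one_sub_div_two {x : R} {q : ℤ} (hx : x ^ 2 = q) (hq : q % 4 = 1) :
    IsIntegral ℤ ((1 - x) / 2) := by
  rw [sub_eq_add_neg]
  exact isIntegral_one_add_div_two (x := -x) (by rw [neg_sq, hx]) hq

theorem isIntegral_div_two {x : R} (hx : x ^ 2 = 8) : IsIntegral ℤ (x / 2) := by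
  refine IsIntegral.of_pow two_pos ?_
  have : (x / 2) ^ 2 = algebraMap ℤ R 2 := by rw [div_pow, hx]; norm_num
  rw [this]
  exact isIntegral_algebraMap

theorem isIntegral_basis (hu : 1 ≤ u) (hw : ∀ i, w i ^ 2 = Q i) (h0 : Q 0 = 8) (hn : n ≠ 0)
    (hQ : ∀ i, i ≠ 0 → Q i % 4 = 1) (s : Fin n → Fin 2) :
    IsIntegral ℤ (realBasis u w s) ∧ IsIntegral ℤ (imagBasis u w s) := by
  have hA : ∀ i, i ≠ 0 → IsIntegral ℤ ((1 + w i) / 2) := fun i hi =>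
    isIntegral_one_add_div_two (hw i) (hQ i hi)
  have hB : ∀ i, i ≠ 0 → IsIntegral ℤ ((1 - w i) / 2) := fun i hi =>
    isIntegral_one_sub_div_two (hw i) (hQ i hi)
  have hl : Fin.last n ≠ 0 := fun h => hn (by simpa using congrArg Fin.val h)
  have hne : ∀ i : Fin n, (i : ℕ) ≠ 0 → i.castSucc ≠ 0 := fun i hi h =>
    hi (by simpa using congrArg Fin.val h)
  have hC : ∀ i : Fin n, (i : ℕ) = 0 → IsIntegral ℤ (w i.castSucc / 2) := by
    intro i hi
    have : i.castSucc = 0 := Fin.ext (by simpa using hi)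
    rw [this]
    exact isIntegral_div_two (by rw [hw, h0]; simp)
  have h1 : ∀ i : Fin n, IsIntegral ℤ (factor i (s i) (w i.castSucc)) := by
    intro i
    unfold factor
    split_ifs with h
    · exact (hC i h).pow _
    · exact ((hB _ (hne i h)).pow _).mul ((hA _ (hne i h)).pow _)
  have h2 : ∀ i : Fin n, IsIntegral ℤ (dualFactor i (s i) (w i.castSucc)) := by
    intro i
    unfold dualFactor
    split_ifs with h
    · exact (hC i h).pow _
    · exact ((hB _ (hne i h)).neg.pow _).mul ((hA _ (hne i h)).pow _)
  have h3 : ∀ i : Fin n, IsIntegral ℤ (factorConj u i (s i) (w i.castSucc)) := by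
    intro i
    unfold factorConj
    split_ifs with h
    · have := hne i (by omega)
      exact ((hB _ this).pow _).mul ((hA _ this).pow _)
    · exact h1 i
  have h4 : ∀ i : Fin n, IsIntegral ℤ (dualFactorConj u i (s i) (w i.castSucc)) := by
    intro i
    unfold dualFactorConj
    split_ifs with h
    · have := hne i (by omega)
      exact ((hB _ this).pow _).mul ((hA _ this).neg.pow _)
    · exact h2 i
  exact ⟨((IsIntegral.prod _ fun i _ => h1 i).mul (hA _ hl)).add
      ((IsIntegral.prod _ fun i _ => h3 i).mul (hB _ hl)),
    ((IsIntegral.prod _ fun i _ => h2 i).mul (hA _ hl)).sub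
      ((IsIntegral.prod _ fun i _ => h4 i).mul (hB _ hl))⟩

end integrality

end

theorem Int.sign_prod {ι : Type*} (s : Finset ι) (f : ι → ℤ) :
    (∏ i ∈ s, f i).sign = ∏ i ∈ s, (f i).sign :=
  map_prod (⟨⟨Int.sign, Int.sign_one⟩, Int.sign_mul⟩ : ℤ →* ℤ) f s

theorem mem_span_of_sum_mul_eq {K ι : Type*} [Field K] [Fintype ι] {D x : K}
    (hD : D ≠ 0) {b T : ι → K} (hT : ∀ s, ∃ k : ℤ, T s = k * D) (h : ∑ s, b s * T s = D * x) :
    x ∈ Submodule.span ℤ (Set.range b) := by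
  choose k hk using hT
  have hx : x = ∑ s, k s • b s := by
    apply mul_left_cancel₀ hD
    rw [← h, Finset.mul_sum]
    refine Finset.sum_congr rfl fun s _ => ?_
    rw [hk, zsmul_eq_mul]
    ring
  rw [hx]
  exact sum_mem fun s _ => Submodule.smul_mem _ _ (Submodule.subset_span ⟨s, rfl⟩)

section

variable {K : Type*} [Field K] [Algebra ℚ K] {n : ℕ} {τ : (Fin n → Fin 2) → K ≃ₐ[ℚ] K}

theorem twisted_sum_mul_sum {D : K} {b b' : (Fin n → Fin 2) → K}
    (hdual : ∀ η ν, ∑ μ, (-1) ^ (∑ i, (μ i : ℕ)) * (τ μ (b η) * τ μ (b' ν)) =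
      if η = ν then D else 0) (a : (Fin n → Fin 2) → ℤ) (ν : Fin n → Fin 2) :
    ∑ μ, (-1) ^ (∑ i, (μ i : ℕ)) * (τ μ (∑ η, a η • b η) * τ μ (b' ν)) = a ν * D := by
  simp only [map_sum, zsmul_eq_mul, map_mul, map_intCast, Finset.sum_mul, Finset.mul_sum]
  rw [Finset.sum_comm]
  have h : ∀ η, ∑ μ, (-1) ^ (∑ i, (μ i : ℕ)) * ((a η : K) * τ μ (b η) * τ μ (b' ν)) =
      a η * if η = ν then D else 0 := by
    intro η
    rw [← hdual, Finset.mul_sum]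
    exact Finset.sum_congr rfl fun μ _ => by ring
  simp [h]

theorem linearIndependent_of_dual {D : K} (hD : D ≠ 0) {b b' : (Fin n → Fin 2) → K}
    (hdual : ∀ η ν, ∑ μ, (-1) ^ (∑ i, (μ i : ℕ)) * (τ μ (b η) * τ μ (b' ν)) =
      if η = ν then D else 0) : LinearIndependent ℤ b := by
  have hchar : CharZero K := algebraRat.charZero K
  rw [Fintype.linearIndependent_iff]
  intro a ha ν
  have h := twisted_sum_mul_sum hdual a ν
  rw [ha] at h
  simpa [hD] using h

theorem sum_dual_mul_twisted {D : K} (hD : D ≠ 0) {b b' : (Fin n → Fin 2) → K}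
    (hdual : ∀ η ν, ∑ μ, (-1) ^ (∑ i, (μ i : ℕ)) * (τ μ (b η) * τ μ (b' ν)) =
      if η = ν then D else 0) (μ ν : Fin n → Fin 2) :
    ∑ s, τ μ (b' s) * ((-1) ^ (∑ i, (ν i : ℕ)) * τ ν (b s)) = if μ = ν then D else 0 := by
  let B : Matrix (Fin n → Fin 2) (Fin n → Fin 2) K := fun η μ =>
    D⁻¹ * ((-1) ^ (∑ i, (μ i : ℕ)) * τ μ (b η))
  let C : Matrix (Fin n → Fin 2) (Fin n → Fin 2) K := fun μ ν => τ μ (b' ν)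
  have hBC : B * C = 1 := by
    ext η ν
    rw [Matrix.mul_apply, Matrix.one_apply]
    have h : ∀ μ, B η μ * C μ ν =
        D⁻¹ * ((-1) ^ (∑ i, (μ i : ℕ)) * (τ μ (b η) * τ μ (b' ν))) := fun μ => by
      simp only [B, C]; ring
    rw [Finset.sum_congr rfl fun μ _ => h μ, ← Finset.mul_sum, hdual]
    split_ifs <;> simp [hD]
  have hCB1 : C * B = 1 := mul_eq_one_comm.1 hBC
  have hCB := congrFun (congrFun hCB1 μ) ν
  rw [Matrix.mul_apply, Matrix.one_apply] at hCB
  have h : ∀ s, τ μ (b' s) * ((-1) ^ (∑ i, (ν i : ℕ)) * τ ν (b s)) = D * (C μ s * B s ν) :=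
    fun s => by simp only [B, C]; field_simp
  rw [Finset.sum_congr rfl fun s _ => h s, ← Finset.mul_sum, hCB]
  split_ifs <;> simp

theorem mem_span_left_of_dual {D x : K} (hD : D ≠ 0) {b b' : (Fin n → Fin 2) → K}
    (hdual : ∀ η ν, ∑ μ, (-1) ^ (∑ i, (μ i : ℕ)) * (τ μ (b η) * τ μ (b' ν)) =
      if η = ν then D else 0) (hτ0 : ∀ z, τ 0 z = z)
    (hx : ∀ s, ∃ k : ℤ, ∑ μ, (-1) ^ (∑ i, (μ i : ℕ)) * τ μ (x * b' s) = k * D) :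
    x ∈ Submodule.span ℤ (Set.range b) := by
  refine mem_span_of_sum_mul_eq hD hx ?_
  simp only [Finset.mul_sum]
  rw [Finset.sum_comm]
  have h : ∀ μ, ∑ s, b s * ((-1) ^ (∑ i, (μ i : ℕ)) * τ μ (x * b' s)) =
      (-1) ^ (∑ i, (μ i : ℕ)) * τ μ x * if μ = 0 then D else 0 := by
    intro μ
    rw [← sum_dual_mul_twisted hD hdual, Finset.mul_sum]
    refine Finset.sum_congr rfl fun s _ => ?_
    rw [map_mul, hτ0]
    simp
    ring
  rw [Finset.sum_congr rfl fun μ _ => h μ]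
  simp [hτ0, mul_comm]

theorem mem_span_right_of_dual {D x : K} (hD : D ≠ 0) {b b' : (Fin n → Fin 2) → K}
    (hdual : ∀ η ν, ∑ μ, (-1) ^ (∑ i, (μ i : ℕ)) * (τ μ (b η) * τ μ (b' ν)) =
      if η = ν then D else 0) (hτ0 : ∀ z, τ 0 z = z)
    (hx : ∀ s, ∃ k : ℤ, ∑ μ, (-1) ^ (∑ i, (μ i : ℕ)) * τ μ (x * b s) = k * D) :
    x ∈ Submodule.span ℤ (Set.range b') := by
  refine mem_span_of_sum_mul_eq hD hx ?_
  simp only [Finset.mul_sum]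
  rw [Finset.sum_comm]
  have h : ∀ μ, ∑ s, b' s * ((-1) ^ (∑ i, (μ i : ℕ)) * τ μ (x * b s)) =
      τ μ x * if 0 = μ then D else 0 := by
    intro μ
    rw [← sum_dual_mul_twisted hD hdual, Finset.mul_sum]
    refine Finset.sum_congr rfl fun s _ => ?_
    rw [map_mul, hτ0]
    ring
  rw [Finset.sum_congr rfl fun μ _ => h μ]
  simp [hτ0, mul_comm]

end

theorem csqrt_sq (x : ℝ) : csqrt x ^ 2 = x := by
  unfold csqrt
  split_ifs with h
  · rw [mul_pow, Complex.I_sq, ← Complex.ofReal_pow, Real.sq_sqrt (by linarith)]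
    simp
  · rw [← Complex.ofReal_pow, Real.sq_sqrt (by linarith)]

theorem conj_csqrt (x : ℝ) :
    starRingEnd ℂ (csqrt x) = if x < 0 then -csqrt x else csqrt x := by
  unfold csqrt
  split_ifs <;> simp

theorem csqrt_eight : csqrt 8 = 2 * (Real.sqrt 2 : ℂ) := by
  have h : Real.sqrt 8 = 2 * Real.sqrt 2 := by
    rw [show (8 : ℝ) = 2 ^ 2 * 2 by norm_num, Real.sqrt_mul (by norm_num),
      Real.sqrt_sq (by norm_num)]
  rw [csqrt, if_neg (by norm_num), h]
  simp

theorem IsPrimeDiscriminant.prime_and_mod_four {q : ℤ} (hq : IsPrimeDiscriminant q)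
    (hodd : Odd q) : Prime q ∧ q % 4 = 1 := by
  rcases hq with ⟨p, hp, hp2, rfl⟩ | rfl | rfl | rfl
  · have hp' := Nat.prime_iff_prime_int.1 hp
    rcases Nat.even_or_odd ((p - 1) / 2) with h | h
    · rw [h.neg_one_pow, one_mul]
      refine ⟨hp', ?_⟩
      obtain ⟨k, hk⟩ := h
      obtain ⟨l, hl⟩ := hp2
      omega
    · rw [h.neg_one_pow, neg_one_mul]
      refine ⟨hp'.neg, ?_⟩
      obtain ⟨k, hk⟩ := h
      obtain ⟨l, hl⟩ := hp2
      omega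
  all_goals exact absurd hodd (by decide)

theorem prod_ne_sq_of_pairwise_isCoprime {ι : Type*} [DecidableEq ι] {Q : ι → ℤ}
    (hcop : Pairwise fun i j => IsCoprime (Q i) (Q j)) (hQ : ∀ i, Q i = 8 ∨ Prime (Q i))
    {S : Finset ι} (hS : S.Nonempty) (k : ℤ) : ∏ i ∈ S, Q i ≠ k ^ 2 := by
  intro hk
  obtain ⟨i, hi⟩ := hS
  rw [← Finset.mul_prod_erase S Q hi] at hk
  have hc : IsCoprime (Q i) (∏ j ∈ S.erase i, Q j) :=
    IsCoprime.prod_right fun j hj => hcop (Finset.ne_of_mem_erase hj).symm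
  obtain ⟨a, ha⟩ := Int.sq_of_isCoprime hc hk
  rcases hQ i with h | h
  · rw [h] at ha
    rcases ha with ha | ha
    · have h1 : a < 3 := by nlinarith
      have h2 : -3 < a := by nlinarith
      interval_cases a <;> omega
    · nlinarith [sq_nonneg a]
  · rcases ha with ha | ha
    · exact h.not_isSquare ⟨a, by rw [ha, sq]⟩
    · exact h.neg.not_isSquare ⟨a, by rw [ha, neg_neg, sq]⟩

theorem realBasis_csqrt_eq {n u : ℕ} (hn : 0 < n) {Q : Fin (n + 1) → ℤ} (h1 : Q 0 = 8)
    (hu1 : 1 ≤ u) {a abar : Fin (n + 1) → ℂ}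
    (ha : ∀ i, i ≠ 0 → a i = (1 + csqrt (Q i : ℝ)) / 2)
    (habar : ∀ i, i ≠ 0 → abar i = (1 - csqrt (Q i : ℝ)) / 2) (s : Fin n → Fin 2) :
    realBasis u (fun i => csqrt (Q i : ℝ)) s = (Real.sqrt 2 : ℂ) ^ (s ⟨0, hn⟩ : ℕ) *
        (∏ i : Fin n, if 0 < (i : ℕ) ∧ (i : ℕ) < u then
          abar i.castSucc ^ (s i : ℕ) * a i.castSucc ^ (1 - (s i : ℕ)) else 1) *
        ((∏ i : Fin n, if u ≤ (i : ℕ) then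
            abar i.castSucc ^ (s i : ℕ) * a i.castSucc ^ (1 - (s i : ℕ)) else 1) *
            a (Fin.last n) +
         (∏ i : Fin n, if u ≤ (i : ℕ) then
            abar i.castSucc ^ (1 - (s i : ℕ)) * a i.castSucc ^ (s i : ℕ) else 1) *
            abar (Fin.last n)) := by
  have hl : Fin.last n ≠ 0 := fun h => hn.ne' (by simpa using congrArg Fin.val h)
  have h0 : (Real.sqrt 2 : ℂ) ^ (s ⟨0, hn⟩ : ℕ) =
      ∏ i : Fin n, if (i : ℕ) = 0 then (csqrt (Q i.castSucc : ℝ) / 2) ^ (s i : ℕ) else 1 := by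
    rw [Finset.prod_eq_single ⟨0, hn⟩ (fun i _ hi => if_neg fun h => hi (Fin.ext h)) (by simp)]
    have : (⟨0, hn⟩ : Fin n).castSucc = 0 := rfl
    rw [if_pos rfl, this, h1, Int.cast_ofNat, csqrt_eight]
    simp
  rw [realBasis, ha _ hl, habar _ hl, h0, mul_add, ← mul_assoc, ← mul_assoc,
    ← Finset.prod_mul_distrib, ← Finset.prod_mul_distrib, ← Finset.prod_mul_distrib]
  congr 2 <;>
  · refine Finset.prod_congr rfl fun i _ => ?_
    rcases Nat.eq_zero_or_pos (i : ℕ) with h | h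
    · have h2 : ¬ u ≤ 0 := by omega
      simp [factor, factorConj, h, h2]
    · have hne : i.castSucc ≠ 0 := fun h' => h.ne' (by simpa using congrArg Fin.val h')
      rw [ha _ hne, habar _ hne]
      by_cases h2 : u ≤ (i : ℕ)
      · simp [factor, factorConj, h.ne', h2, not_lt.2 h2]
      · simp [factor, factorConj, h.ne', h2, not_le.1 h2, h]

theorem imagBasis_csqrt_eq {n u : ℕ} (hn : 0 < n) {Q : Fin (n + 1) → ℤ} (h1 : Q 0 = 8)
    (hu1 : 1 ≤ u) {a abar : Fin (n + 1) → ℂ}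
    (ha : ∀ i, i ≠ 0 → a i = (1 + csqrt (Q i : ℝ)) / 2)
    (habar : ∀ i, i ≠ 0 → abar i = (1 - csqrt (Q i : ℝ)) / 2) (s : Fin n → Fin 2) :
    imagBasis u (fun i => csqrt (Q i : ℝ)) s = (Real.sqrt 2 : ℂ) ^ (1 - (s ⟨0, hn⟩ : ℕ)) *
        (∏ i : Fin n, if 0 < (i : ℕ) ∧ (i : ℕ) < u then
          (-abar i.castSucc) ^ (s i : ℕ) * a i.castSucc ^ (1 - (s i : ℕ)) else 1) *
        ((∏ i : Fin n, if u ≤ (i : ℕ) then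
            (-abar i.castSucc) ^ (s i : ℕ) * a i.castSucc ^ (1 - (s i : ℕ)) else 1) *
            a (Fin.last n) -
         (∏ i : Fin n, if u ≤ (i : ℕ) then
            abar i.castSucc ^ (1 - (s i : ℕ)) * (-a i.castSucc) ^ (s i : ℕ) else 1) *
            abar (Fin.last n)) := by
  have hl : Fin.last n ≠ 0 := fun h => hn.ne' (by simpa using congrArg Fin.val h)
  have h0 : (Real.sqrt 2 : ℂ) ^ (1 - (s ⟨0, hn⟩ : ℕ)) =
      ∏ i : Fin n, if (i : ℕ) = 0 then (csqrt (Q i.castSucc : ℝ) / 2) ^ (1 - (s i : ℕ))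
        else 1 := by
    rw [Finset.prod_eq_single ⟨0, hn⟩ (fun i _ hi => if_neg fun h => hi (Fin.ext h)) (by simp)]
    have : (⟨0, hn⟩ : Fin n).castSucc = 0 := rfl
    rw [if_pos rfl, this, h1, Int.cast_ofNat, csqrt_eight]
    simp
  rw [imagBasis, ha _ hl, habar _ hl, h0, mul_sub, ← mul_assoc, ← mul_assoc,
    ← Finset.prod_mul_distrib, ← Finset.prod_mul_distrib, ← Finset.prod_mul_distrib]
  congr 2 <;>
  · refine Finset.prod_congr rfl fun i _ => ?_
    rcases Nat.eq_zero_or_pos (i : ℕ) with h | h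
    · have h2 : ¬ u ≤ 0 := by omega
      simp [dualFactor, dualFactorConj, h, h2]
    · have hne : i.castSucc ≠ 0 := fun h' => h.ne' (by simpa using congrArg Fin.val h')
      rw [ha _ hne, habar _ hne]
      by_cases h2 : u ≤ (i : ℕ)
      · simp [dualFactor, dualFactorConj, h.ne', h2, not_lt.2 h2]
      · simp [dualFactor, dualFactorConj, h.ne', h2, not_le.1 h2, h]

/- Here `t = t' + 1`: the (1-based) indices `1, …, t−1` correspond to `i.castSucc` for
`i : Fin t'` (so `q_1* = Q 0 = 8`), the index `t` corresponds to `Fin.last t'`;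
sets `s ∈ {0,1}^{t−1}` are functions `s : Fin t' → Fin 2` (`s_1 = s 0`). -/
theorem stmt12 (t' : ℕ) (d : ℤ) (hd : IsNegFundamentalDiscriminant d)
    (Q : Fin (t' + 1) → ℤ) (hQ : ∀ i, IsPrimeDiscriminant (Q i))
    (hcop : Pairwise fun i j => IsCoprime (Q i) (Q j)) (hprod : d = ∏ i, Q i)
    (h1 : Q 0 = 8) (hodd : ∀ i, i ≠ 0 → Odd (Q i))
    (u : ℕ) (hu1 : 1 ≤ u) (hu : u ≤ t')
    (hsign : ∀ i : Fin (t' + 1), ((i : ℕ) < u → 0 < Q i) ∧ (u ≤ (i : ℕ) → Q i < 0))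
    (a abar : Fin (t' + 1) → ℂ)
    (ha : ∀ i, i ≠ 0 → a i = (1 + csqrt (Q i : ℝ)) / 2)
    (habar : ∀ i, i ≠ 0 → abar i = (1 - csqrt (Q i : ℝ)) / 2)
    -- `K_G = ℚ(√q_1*, …, √q_t*)` generated inside `ℂ`
    (K : IntermediateField ℚ ℂ)
    (hK : K = IntermediateField.adjoin ℚ (Set.range fun i => csqrt (Q i : ℝ)))
    (β βstar : (Fin t' → Fin 2) → ℂ)
    (hβ : ∀ s, β s =
      (Real.sqrt 2 : ℂ) ^ (s ⟨0, by omega⟩ : ℕ) *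
        (∏ i : Fin t', if 0 < (i : ℕ) ∧ (i : ℕ) < u then
          abar i.castSucc ^ (s i : ℕ) * a i.castSucc ^ (1 - (s i : ℕ)) else 1) *
        ((∏ i : Fin t', if u ≤ (i : ℕ) then
            abar i.castSucc ^ (s i : ℕ) * a i.castSucc ^ (1 - (s i : ℕ)) else 1) *
            a (Fin.last t') +
         (∏ i : Fin t', if u ≤ (i : ℕ) then
            abar i.castSucc ^ (1 - (s i : ℕ)) * a i.castSucc ^ (s i : ℕ) else 1) *
            abar (Fin.last t')))
    (hβstar : ∀ s, βstar s =
      (Real.sqrt 2 : ℂ) ^ (1 - (s ⟨0, by omega⟩ : ℕ)) *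
        (∏ i : Fin t', if 0 < (i : ℕ) ∧ (i : ℕ) < u then
          (-abar i.castSucc) ^ (s i : ℕ) * a i.castSucc ^ (1 - (s i : ℕ)) else 1) *
        ((∏ i : Fin t', if u ≤ (i : ℕ) then
            (-abar i.castSucc) ^ (s i : ℕ) * a i.castSucc ^ (1 - (s i : ℕ)) else 1) *
            a (Fin.last t') -
         (∏ i : Fin t', if u ≤ (i : ℕ) then
            abar i.castSucc ^ (1 - (s i : ℕ)) * (-a i.castSucc) ^ (s i : ℕ) else 1) *
            abar (Fin.last t'))) :
    IsIntBasisReal K β ∧ IsIntBasisImag K βstar ∧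
      ∀ τ : (Fin t' → Fin 2) → (K ≃ₐ[ℚ] K),
        (∀ (μ : Fin t' → Fin 2) (i : Fin t') (x : K),
          (x : ℂ) = csqrt (Q i.castSucc : ℝ) →
            ((τ μ x : K) : ℂ) = (-1 : ℂ) ^ (μ i : ℕ) * csqrt (Q i.castSucc : ℝ)) →
        (∀ (μ : Fin t' → Fin 2) (x : K),
          (x : ℂ) = csqrt (Q (Fin.last t') : ℝ) →
            ((τ μ x : K) : ℂ) = csqrt (Q (Fin.last t') : ℝ)) →
        ∀ η ν : Fin t' → Fin 2, ∀ z : K, (z : ℂ) = β η * βstar ν →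
          ∑ μ : Fin t' → Fin 2,
              (-1 : ℂ) ^ (∑ i, (μ i : ℕ)) * ((τ μ z : K) : ℂ) =
            if η = ν then ∏ i, csqrt (Q i : ℝ) else 0 := by
  have hn : 0 < t' := by omega
  have hlast : Fin.last t' ≠ 0 := fun h => hn.ne' (by simpa using congrArg Fin.val h)
  have hpd : ∀ i, i ≠ 0 → Prime (Q i) ∧ Q i % 4 = 1 := fun i hi =>
    (hQ i).prime_and_mod_four (hodd i hi)
  have hQ8 : ∀ i, Q i = 8 ∨ Prime (Q i) := fun i => by
    by_cases hi : i = 0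
    · exact Or.inl (hi ▸ h1)
    · exact Or.inr (hpd i hi).1
  obtain ⟨e, he, he2, hde⟩ : ∃ e, Squarefree e ∧ Even e ∧ ∏ i, Q i = 4 * e := by
    have h8 : 8 ∣ d := by
      rw [hprod, ← h1]
      exact Finset.dvd_prod_of_mem Q (Finset.mem_univ 0)
    rcases hd.2 with h | h
    · omega
    · refine ⟨d / 4, h.2.1, ?_, by rw [← hprod]; omega⟩
      rw [even_iff_two_dvd]
      omega
  have hsignR : ∀ i : Fin (t' + 1), ((Q i : ℝ) < 0 ↔ u ≤ (i : ℕ)) := fun i => by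
    rw [Int.cast_lt_zero]
    refine ⟨fun h => ?_, (hsign i).2⟩
    by_contra h'
    exact absurd ((hsign i).1 (not_le.1 h')) h.not_gt
  have hparZ : ∏ i : Fin t', (if u ≤ (i : ℕ) then -1 else 1 : ℤ) = 1 := by
    have hpos : 0 < ∏ i : Fin t', Q i.castSucc := by
      have hneg := hd.1
      rw [hprod, Fin.prod_univ_castSucc] at hneg
      exact pos_of_mul_neg_left hneg ((hsign (Fin.last t')).2 (by simpa using hu)).le
    rw [← Int.sign_eq_one_iff_pos, Int.sign_prod] at hpos
    refine (Finset.prod_congr rfl fun i _ => ?_).trans hpos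
    split_ifs with h
    · exact (Int.sign_eq_neg_one_of_neg ((hsign i.castSucc).2 h)).symm
    · exact (Int.sign_eq_one_of_pos ((hsign i.castSucc).1 (not_le.1 h))).symm
  have hwmem : ∀ i, csqrt (Q i : ℝ) ∈ K := fun i =>
    hK ▸ IntermediateField.subset_adjoin _ _ ⟨i, rfl⟩
  let w : Fin (t' + 1) → K := fun i => ⟨csqrt (Q i : ℝ), hwmem i⟩
  have hw : ∀ i, w i ^ 2 = Q i := fun i => Subtype.ext (by simp [w, csqrt_sq])
  have hpar : ∏ i : Fin t', (if u ≤ (i : ℕ) then -1 else 1 : K) = 1 := by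
    have := congrArg (Int.cast : ℤ → K) hparZ
    simpa using this
  have hextC : ∀ φ ψ : K →+* ℂ, (∀ i, φ (w i) = ψ (w i)) → ∀ x, φ x = ψ x := fun φ ψ h x => by
    have hφψ : φ.toRatAlgHom = ψ.toRatAlgHom :=
      IntermediateField.algHom_ext_of_eq_adjoin ℚ hK (by rintro _ ⟨i, rfl⟩; exact h i)
    exact DFunLike.congr_fun hφψ x
  have hext : ∀ σ σ' : K ≃ₐ[ℚ] K, (∀ i, σ (w i) = σ' (w i)) → σ = σ' := fun σ σ' h =>
    AlgEquiv.ext fun x => Subtype.ext <|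
      hextC ((algebraMap K ℂ).comp (σ : K →+* K)) ((algebraMap K ℂ).comp (σ' : K →+* K))
        (fun i => congrArg Subtype.val (h i)) x
  have hgal : IsGalois ℚ K := by
    rw [hK]
    exact isGalois_adjoin_range_of_sq _ (fun i => (Q i : ℚ)) fun i => by simp [csqrt_sq]
  have hind : ∀ S : Finset (Fin (t' + 1)), S.Nonempty →
      ∏ i ∈ S, w i ∉ Set.range (algebraMap ℚ K) := by
    rintro S hS ⟨r, hr⟩
    have hr2 : r ^ 2 = ((∏ i ∈ S, Q i : ℤ) : ℚ) := by
      apply (algebraMap ℚ K).injective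
      rw [map_pow, hr, ← Finset.prod_pow, Finset.prod_congr rfl fun i _ => hw i]
      simp
    obtain ⟨k, rfl⟩ := Rat.exists_int_eq_of_sq_mul_squarefree (q := 1) squarefree_one
      (m := ∏ i ∈ S, Q i) (by rw [Int.cast_one, mul_one, hr2])
    exact prod_ne_sq_of_pairwise_isCoprime hcop hQ8 hS k (by exact_mod_cast hr2.symm)
  have hsigns := exists_algEquiv_neg_one_pow_mul (F := ℚ) w
    (fun i => ⟨Q i, by rw [hw]; simp⟩) hind
  obtain ⟨c, hc⟩ := hsigns fun i => if u ≤ (i : ℕ) then 1 else 0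
  have hc' : ∀ i, c (w i) = if u ≤ (i : ℕ) then -w i else w i := fun i => by
    rw [hc]; split_ifs <;> simp
  have hcl : c (w (Fin.last t')) = -w (Fin.last t') := by
    rw [hc', if_pos (by simpa using hu)]
  have hconj : ∀ x : K, ((c x : K) : ℂ) = starRingEnd ℂ (x : ℂ) :=
    hextC ((algebraMap K ℂ).comp (c : K →+* K)) ((starRingEnd ℂ).comp (algebraMap K ℂ)) fun i => by
      change ((c (w i) : K) : ℂ) = starRingEnd ℂ (csqrt (Q i : ℝ))
      rw [hc', conj_csqrt, if_congr (hsignR i) rfl rfl]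
      split_ifs <;> simp [w]
  have hcw : c (∏ i, w i) = -∏ i, w i := by
    have h : ∀ i : Fin t', c (w i.castSucc) =
        (if u ≤ (i : ℕ) then -1 else 1) * w i.castSucc := fun i => by
      rw [hc']; simp only [Fin.val_castSucc]; split_ifs <;> simp
    rw [Fin.prod_univ_castSucc, map_mul, hcl, map_prod, Finset.prod_congr rfl fun i _ => h i,
      Finset.prod_mul_distrib, hpar]
    ring
  have hβK : ∀ s, ((realBasis u w s : K) : ℂ) = β s := fun s => by
    rw [hβ, ← realBasis_csqrt_eq hn h1 hu1 ha habar]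
    exact map_realBasis (algebraMap K ℂ) w s
  have hβsK : ∀ s, ((imagBasis u w s : K) : ℂ) = βstar s := fun s => by
    rw [hβstar, ← imagBasis_csqrt_eq hn h1 hu1 ha habar]
    exact map_imagBasis (algebraMap K ℂ) w s
  have hdual : ∀ τ : (Fin t' → Fin 2) → (K ≃ₐ[ℚ] K),
      (∀ μ i, τ μ (w (Fin.castSucc i)) = (-1) ^ (μ i : ℕ) * w i.castSucc) →
      (∀ μ, τ μ (w (Fin.last t')) = w (Fin.last t')) → ∀ η ν,
      ∑ μ, (-1) ^ (∑ i, (μ i : ℕ)) * (τ μ (realBasis u w η) * τ μ (imagBasis u w ν)) =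
        if η = ν then ∏ i, w i else 0 := by
    intro τ hτ hτl η ν
    rw [← sum_realBasis_mul_imagBasis hu1 hpar w (fun μ i => τ μ (w i)) hτ hτl]
    refine Finset.sum_congr rfl fun μ _ => ?_
    congr 2
    · exact map_realBasis (τ μ : K →+* K) w η
    · exact map_imagBasis (τ μ : K →+* K) w ν
  choose τ hτ using fun μ : Fin t' → Fin 2 =>
    hsigns (Fin.snoc (α := fun _ => Fin 2) μ 0)
  have hτc : ∀ μ i, τ μ (w (Fin.castSucc i)) = (-1) ^ (μ i : ℕ) * w i.castSucc := fun μ i => by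
    rw [hτ, Fin.snoc_castSucc]
  have hτl : ∀ μ, τ μ (w (Fin.last t')) = w (Fin.last t') := fun μ => by
    rw [hτ, Fin.snoc_last]; simp
  have hτ0 : ∀ z, τ 0 z = z := by
    have h : τ 0 = AlgEquiv.refl := hext _ _ fun i => by
      induction i using Fin.lastCases with
      | last => rw [hτl]; rfl
      | cast i => rw [hτc]; simp
    intro z
    rw [h]; rfl
  have hD : ∏ i, w i ≠ 0 := by
    refine Finset.prod_ne_zero_iff.2 fun i _ h => hind {i} ⟨i, by simp⟩ ?_
    exact ⟨0, by simp [h]⟩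
  have hcore : ∀ y : K, IsIntegral ℤ y → c y = -y →
      ∃ k : ℤ, ∑ μ, (-1) ^ (∑ i, (μ i : ℕ)) * τ μ y = k * ∏ i, w i := fun y hy hcy =>
    exists_int_twisted_sum_eq_mul_prod hw hext hτc hτl
      (fun i => by rw [hc']; split_ifs <;> simp) hcl hcw he he2 hde
      (hpd _ hlast).1.irreducible.squarefree (hodd _ hlast) hy hcy
  have hint := isIntegral_basis hu1 hw h1 hn.ne' fun i hi => (hpd i hi).2
  have hcβ : ∀ s, c (realBasis u w s) = realBasis u w s := fun s =>
    (map_realBasis (c : K →+* K) w s).trans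
      (realBasis_conj hu1 (fun i => hc' i.castSucc) hcl s)
  have hcβs : ∀ s, c (imagBasis u w s) = -imagBasis u w s := fun s =>
    (map_imagBasis (c : K →+* K) w s).trans
      (imagBasis_conj hu1 (fun i => hc' i.castSucc) hcl s)
  have hre : ∀ x : K, c x = x ↔ (x : ℂ).im = 0 := fun x => by
    rw [← Complex.conj_eq_iff_im, ← hconj, Subtype.ext_iff]
  have him : ∀ x : K, c x = -x ↔ (x : ℂ).re = 0 := fun x => by
    rw [Subtype.ext_iff, hconj, Complex.ext_iff]
    simp
    constructor <;> intro h <;> linarith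
  let f : K →ₗ[ℤ] ℂ := K.val.toLinearMap.restrictScalars ℤ
  have hf : Function.Injective f := Subtype.val_injective
  have hfβ : β = f ∘ realBasis u w := funext fun s => (hβK s).symm
  have hfβs : βstar = f ∘ imagBasis u w := funext fun s => (hβsK s).symm
  have hintK : ∀ x : K, IsIntegral ℤ (x : ℂ) ↔ IsIntegral ℤ x := fun x =>
    isIntegral_algebraMap_iff (A := K) (B := ℂ) Subtype.val_injective
  refine ⟨⟨fun s => ?_, fun s => ?_, fun s => ?_, ?_, fun x hx hxi hxr => ?_⟩,
    ⟨fun s => ?_, fun s => ?_, fun s => ?_, ?_, fun x hx hxi hxr => ?_⟩, ?_⟩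
  · rw [← hβK]; exact SetLike.coe_mem _
  · rw [← hβK, hintK]; exact (hint s).1
  · rw [← hβK, ← hre]; exact hcβ s
  · rw [hfβ]
    exact (linearIndependent_of_dual hD (hdual τ hτc hτl)).map' f (LinearMap.ker_eq_bot.2 hf)
  · lift x to K using hx
    rw [hfβ, Set.range_comp, Submodule.span_image]
    refine Submodule.mem_map_of_mem (f := f)
      (mem_span_left_of_dual hD (hdual τ hτc hτl) hτ0 fun s => hcore _ ?_ ?_)
    · exact ((hintK x).1 hxi).mul (hint s).2
    · rw [map_mul, (hre x).2 hxr, hcβs, mul_neg]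
  · rw [← hβsK]; exact SetLike.coe_mem _
  · rw [← hβsK, hintK]; exact (hint s).2
  · rw [← hβsK, ← him]; exact hcβs s
  · rw [hfβs]
    refine (linearIndependent_of_dual (τ := τ) (b' := realBasis u w) hD fun η ν => ?_).map' f
      (LinearMap.ker_eq_bot.2 hf)
    rw [if_congr eq_comm rfl rfl, ← hdual τ hτc hτl ν η]
    exact Finset.sum_congr rfl fun μ _ => by rw [mul_comm (τ μ (imagBasis u w η))]
  · lift x to K using hx
    rw [hfβs, Set.range_comp, Submodule.span_image]
    refine Submodule.mem_map_of_mem (f := f)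
      (mem_span_right_of_dual hD (hdual τ hτc hτl) hτ0 fun s => hcore _ ?_ ?_)
    · exact ((hintK x).1 hxi).mul (hint s).1
    · rw [map_mul, (him x).2 hxr, hcβ, neg_mul]
  · intro τ' hτ' hτl' η ν z hz
    have hzK : z = realBasis u w η * imagBasis u w ν :=
      Subtype.ext (by rw [hz, ← hβK, ← hβsK]; rfl)
    have h := hdual τ' (fun μ i => Subtype.ext (by simpa using hτ' μ i (w i.castSucc) rfl))
      (fun μ => Subtype.ext (hτl' μ (w (Fin.last t')) rfl)) η ν
    have h' := congrArg (algebraMap K ℂ) h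
    simp only [← map_mul, ← hzK] at h'
    rw [map_sum, apply_ite (algebraMap K ℂ), map_prod, map_zero] at h'
    refine (Finset.sum_congr rfl fun μ _ => ?_).trans h'
    rw [map_mul, map_pow, map_neg, map_one]; rfl
end

section
/- Let δ be a positive integer that is not a perfect square, with δ ≡ 0 or 1 (mod 4). Define g ∈ ℝ by g = (1 + √δ)/2 if δ is odd and g = √δ/2 if δ is even, and assume g > 1. Define the sequence of complete quotients of the continued fraction of g by X_0 = g and X_{n+1} = 1/(X_n − ⌊X_n⌋) (each X_n lies in the real quadratic field ℚ(√δ) and is irrational, so the sequence is defined for all n). Let σ be the nontrivial ℚ-automorphism of ℚ(√δ), so that σ(X_n) denotes the Galois conjugate of X_n in ℚ(√δ) ⊂ ℝ, obtained by replacing √δ with −√δ. Then for every n ≥ 1: (1) there exist integers x, y with 0 ≤ x < √δ − g, 0 < y < √δ, and X_n = (g + x)/y; (2) −1 < σ(X_n) < 0. -/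
/-- One step of the continued fraction expansion of a quadratic irrational `(g + x) / y`, where `g`
and `gc` are conjugate with trace `e ≤ 1` and norm `-m`: the next complete quotient is reduced
and has the same shape. -/
theorem exists_reduced_inv_fract {g gc : ℝ} {e m : ℤ} (hadd : g + gc = e) (hmul : g * gc = -m)
    (he1 : e ≤ 1) (hirr : Irrational g) {x y : ℤ} (hy : 0 < y)
    (hdvd : y ∣ x ^ 2 + e * x - m) (hneg : gc + x < 0) (hone : 1 < (g + x) / y) :
    ∃ x' y' : ℤ, 0 ≤ x' ∧ 0 < y' ∧ (y' : ℝ) < g - gc ∧ y' ∣ x' ^ 2 + e * x' - m ∧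
      ((g + x) / y - (⌊(g + x) / y⌋ : ℝ))⁻¹ = (g + x') / y' ∧
      -(y' : ℝ) < gc + x' ∧ gc + x' < 0 ∧ 1 < (g + x') / y' := by
  set a : ℤ := ⌊(g + x) / y⌋ with ha
  have hyR : (0 : ℝ) < y := by exact_mod_cast hy
  have ha1 : (1 : ℝ) ≤ a := by
    exact_mod_cast Int.le_floor.2 (by exact_mod_cast hone.le : ((1 : ℤ) : ℝ) ≤ (g + x) / y)
  have hle : (a : ℝ) * y ≤ g + x := (le_div_iff₀ hyR).1 (Int.floor_le _)
  have hlt : g + x < (a + 1) * y := (div_lt_iff₀ hyR).1 (Int.lt_floor_add_one _)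
  have hne : g + x ≠ a * y := fun h => hirr ⟨(a * y - x : ℤ), by push_cast; linarith⟩
  have hpos : 0 < g + x - a * y := sub_pos.2 (lt_of_le_of_ne hle hne.symm)
  have hay : (y : ℝ) ≤ a * y := le_mul_of_one_le_left hyR.le ha1
  obtain ⟨k, hk⟩ : y ∣ (x - a * y) ^ 2 + e * (x - a * y) - m := by
    obtain ⟨c, hc⟩ := hdvd
    exact ⟨c - 2 * a * x + a ^ 2 * y - e * a, by linear_combination hc⟩
  have hkR : (y : ℝ) * k = (g + x - a * y) * (gc + x - a * y) := by
    have h : (((x - a * y) ^ 2 + e * (x - a * y) - m : ℤ) : ℝ) = ((y * k : ℤ) : ℝ) := by rw [hk]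
    push_cast at h
    linear_combination -h - hmul - (x - a * y : ℝ) * hadd
  have hub : (-k : ℝ) < -(gc + x - a * y) := by
    refine lt_of_mul_lt_mul_left ?_ hyR.le
    nlinarith
  have hlb : g + x - a * y < (-k : ℝ) := by
    refine lt_of_mul_lt_mul_left ?_ hyR.le
    nlinarith
  have hk0 : (0 : ℝ) < -k := hpos.trans hlb
  refine ⟨a * y - x - e, -k, ?_, by exact_mod_cast hk0, ?_, ⟨-y, by linear_combination hk⟩,
    ?_, ?_, ?_, ?_⟩
  · have h : ((-e : ℤ) : ℝ) < ((2 * (a * y - x - e) : ℤ) : ℝ) := by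
      push_cast
      linarith
    have h' : -e < 2 * (a * y - x - e) := by exact_mod_cast h
    omega
  · push_cast
    linarith
  · have h : (g + x) / y - a = (g + x - a * y) / y := by field_simp
    rw [h, inv_div]
    push_cast
    rw [div_eq_div_iff hpos.ne' hk0.ne']
    linear_combination -hkR - (g + x - a * y) * hadd
  · push_cast
    linarith
  · push_cast
    linarith
  · push_cast
    rw [lt_div_iff₀ hk0]
    linarith

/-- `(1 ± √δ) / 2` or `± √δ / 2` are the roots of a monic integral quadratic polynomial. -/
theorem exists_trace_norm {δ : ℕ} (hδns : ¬ IsSquare δ) (hδmod : δ % 4 = 0 ∨ δ % 4 = 1)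
    {g gc : ℝ} (hg : g = if Odd δ then (1 + Real.sqrt δ) / 2 else Real.sqrt δ / 2)
    (hgc : gc = if Odd δ then (1 - Real.sqrt δ) / 2 else -(Real.sqrt δ / 2)) :
    ∃ e m : ℤ, g + gc = e ∧ g * gc = -m ∧ e ≤ 1 ∧ Irrational g ∧
      g - gc = Real.sqrt δ := by
  have hs : Irrational (Real.sqrt δ) := irrational_sqrt_natCast_iff.2 hδns
  have hsq : Real.sqrt δ ^ 2 = δ := Real.sq_sqrt (Nat.cast_nonneg δ)
  have hdiv : (δ : ℝ) = 4 * (δ / 4 : ℕ) + (δ % 4 : ℕ) := by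
    exact_mod_cast (Nat.div_add_mod δ 4).symm
  rcases hδmod with h | h
  · have ho : ¬ Odd δ := by rw [Nat.odd_iff]; omega
    rw [if_neg ho] at hg hgc
    rw [h] at hdiv
    refine ⟨0, (δ / 4 : ℕ), ?_, ?_, zero_le_one, ?_, ?_⟩
    · rw [hg, hgc]; simp
    · rw [hg, hgc, Int.cast_natCast]; push_cast at hdiv; linear_combination -hsq / 4 - hdiv / 4
    · rw [hg]; exact_mod_cast hs.div_natCast two_ne_zero
    · rw [hg, hgc]; ring
  · have ho : Odd δ := by rw [Nat.odd_iff]; omega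
    rw [if_pos ho] at hg hgc
    rw [h] at hdiv
    refine ⟨1, (δ / 4 : ℕ), ?_, ?_, le_rfl, ?_, ?_⟩
    · rw [hg, hgc]; push_cast; ring
    · rw [hg, hgc, Int.cast_natCast]; push_cast at hdiv; linear_combination -hsq / 4 - hdiv / 4
    · rw [hg]; exact_mod_cast (hs.natCast_add 1).div_natCast two_ne_zero
    · rw [hg, hgc]; ring

theorem stmt18 (δ : ℕ) (hδpos : 0 < δ) (hδns : ¬ IsSquare δ)
    (hδmod : δ % 4 = 0 ∨ δ % 4 = 1)
    (g : ℝ)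
    (hg : g = if Odd δ then (1 + Real.sqrt δ) / 2 else Real.sqrt δ / 2)
    (hg1 : 1 < g)
    -- the complete quotients of the continued fraction of `g`
    (X : ℕ → ℝ) (hX0 : X 0 = g)
    (hXrec : ∀ n, X (n + 1) = (X n - (⌊X n⌋ : ℝ))⁻¹)
    -- `gc = σ(g)` is the Galois conjugate of `g`, obtained by replacing `√δ` with `−√δ`
    (gc : ℝ)
    (hgc : gc = if Odd δ then (1 - Real.sqrt δ) / 2 else -(Real.sqrt δ / 2)) :
    ∀ n : ℕ, 1 ≤ n → ∃ x y : ℤ,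
      0 ≤ x ∧ (x : ℝ) < Real.sqrt δ - g ∧
      0 < y ∧ (y : ℝ) < Real.sqrt δ ∧
      X n = (g + (x : ℝ)) / (y : ℝ) ∧
      -- `σ(X_n) = (σ(g) + x)/y ∈ (−1, 0)`
      -1 < (gc + (x : ℝ)) / (y : ℝ) ∧ (gc + (x : ℝ)) / (y : ℝ) < 0 := by
  obtain ⟨e, m, hadd, hmul, he1, hirr, hsub⟩ := exists_trace_norm hδns hδmod hg hgc
  have hgc0 : gc < 0 := by
    have hs1 : 1 < Real.sqrt δ := by
      refine Real.lt_sqrt_of_sq_lt ?_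
      have h1 : δ ≠ 1 := by rintro rfl; exact hδns ⟨1, rfl⟩
      have : 1 < δ := by omega
      simpa using this
    rw [hgc]
    split_ifs <;> linarith
  have step : ∀ n, ∃ x y : ℤ, 0 < y ∧ y ∣ x ^ 2 + e * x - m ∧ gc + x < 0 ∧
      1 < (g + x) / y ∧ X n = (g + x) / y := by
    intro n
    induction n with
    | zero =>
      exact ⟨0, 1, one_pos, one_dvd _, by simpa using hgc0, by simpa using hg1, by simp [hX0]⟩
    | succ n ih =>
      obtain ⟨x, y, hy, hdvd, hneg, hone, hX⟩ := ih
      obtain ⟨x', y', -, hy', -, hdvd', hX', -, hneg', hone'⟩ :=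
        exists_reduced_inv_fract hadd hmul he1 hirr hy hdvd hneg hone
      exact ⟨x', y', hy', hdvd', hneg', hone', by rw [hXrec, hX, hX']⟩
  intro n hn
  obtain ⟨k, rfl⟩ := Nat.exists_eq_add_of_le' hn
  obtain ⟨x, y, hy, hdvd, hneg, hone, hX⟩ := step k
  obtain ⟨x', y', hx0, hy0, hylt, -, hX', hlow, hneg', -⟩ :=
    exists_reduced_inv_fract hadd hmul he1 hirr hy hdvd hneg hone
  have hyR : (0 : ℝ) < y' := by exact_mod_cast hy0
  refine ⟨x', y', hx0, by linarith, hy0, by linarith, by rw [hXrec, hX, hX'], ?_,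
    div_neg_of_neg_of_pos hneg' hyR⟩
  rw [lt_div_iff₀ hyR]
  linarith
end

section
/- Let D < 0 be an integer with D ≡ 0 or 1 (mod 4), and let A, B, C be integers with A > 0, B² − 4AC = D, and gcd(A, D) = 1. Work inside ℂ with √D = i·√|D|. Let O_D = ℤ + ℤ·((D + √D)/2) (a subring of ℂ) and let 𝔞 = ℤ·A + ℤ·((−B + √D)/2) be the ℤ-submodule generated by A and (−B + √D)/2. Then 𝔞 ⊆ O_D, 𝔞 is an ideal of O_D (i.e. α·x ∈ 𝔞 for all α ∈ O_D and x ∈ 𝔞), and the quotient O_D/𝔞 has exactly A elements; in fact every coset of 𝔞 in O_D contains exactly one integer among 0, 1, …, A−1. -/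
theorem csqrt_im_pos {x : ℝ} (hx : x < 0) : 0 < (csqrt x).im := by
  simp [csqrt, hx]

/-- An integral combination of `1` and a non-real complex number determines its coefficients. -/
theorem int_eq_of_add_mul_eq {t : ℂ} (ht : t.im ≠ 0) {p q p' q' : ℤ}
    (h : (p : ℂ) + q * t = p' + q' * t) : p = p' ∧ q = q' := by
  have him := congrArg Complex.im h
  simp [ht] at him
  subst him
  simpa using h

theorem stmt19 (D : ℤ) (hD : D < 0) (hDmod : D % 4 = 0 ∨ D % 4 = 1)
    (A B C : ℤ) (hA : 0 < A) (hdisc : B ^ 2 - 4 * A * C = D)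
    (hcop : IsCoprime A D)
    -- `O_D = ℤ + ℤ·((D + √D)/2)` and `𝔞 = ℤ·A + ℤ·((−B + √D)/2)`, as `ℤ`-submodules of `ℂ`
    (O a : Submodule ℤ ℂ)
    (hO : O = Submodule.span ℤ {1, ((D : ℂ) + csqrt (D : ℝ)) / 2})
    (ha : a = Submodule.span ℤ {(A : ℂ), (-(B : ℂ) + csqrt (D : ℝ)) / 2}) :
    a ≤ O ∧
      (∀ α ∈ O, ∀ x ∈ a, α * x ∈ a) ∧
      -- every coset of `𝔞` in `O_D` contains exactly one integer among `0, …, A−1`;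
      -- in particular `O_D/𝔞` has exactly `A` elements
      ∀ z ∈ O, ∃! k : ℤ, 0 ≤ k ∧ k < A ∧ z - (k : ℂ) ∈ a := by
  subst hO ha
  set s := csqrt (D : ℝ) with hs
  have hs2 : s ^ 2 = (D : ℂ) := by simpa using csqrt_sq (D : ℝ)
  have hsim : 0 < s.im := csqrt_im_pos (by exact_mod_cast hD)
  obtain ⟨n, hn⟩ : ∃ n : ℤ, D + B = 2 * n := by
    obtain ⟨m, hm⟩ := Int.even_mul_succ_self B
    exact ⟨m - 2 * A * C, by linarith⟩
  set t : ℂ := (-(B : ℂ) + s) / 2 with ht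
  have htim : t.im ≠ 0 := by
    have : t.im = s.im / 2 := by simp [ht]
    rw [this]
    positivity
  have hw : ((D : ℂ) + s) / 2 = n + t := by
    have : (D : ℂ) + B = 2 * n := by exact_mod_cast hn
    rw [ht]
    linear_combination this / 2
  have htt : t ^ 2 = -B * t - A * C := by
    have : (B : ℂ) ^ 2 - 4 * A * C = D := by exact_mod_cast hdisc
    rw [ht]
    linear_combination hs2 / 4 - this / 4
  have hmemO (z : ℂ) : z ∈ Submodule.span ℤ {1, ((D : ℂ) + s) / 2} ↔
      ∃ p q : ℤ, (p : ℂ) + q * t = z := by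
    rw [hw, Submodule.mem_span_pair]
    simp only [zsmul_eq_mul]
    constructor
    · rintro ⟨p, q, rfl⟩
      exact ⟨p + q * n, q, by push_cast; ring⟩
    · rintro ⟨p, q, rfl⟩
      exact ⟨p - q * n, q, by push_cast; ring⟩
  have hmema (z : ℂ) : z ∈ Submodule.span ℤ {(A : ℂ), t} ↔
      ∃ x y : ℤ, ((x * A : ℤ) : ℂ) + y * t = z := by
    simp only [Submodule.mem_span_pair, zsmul_eq_mul, Int.cast_mul]
  refine ⟨fun z hz ↦ ?_, fun α hα z hz ↦ ?_, fun z hz ↦ ?_⟩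
  · obtain ⟨x, y, rfl⟩ := (hmema z).1 hz
    exact (hmemO _).2 ⟨_, _, rfl⟩
  · obtain ⟨x, y, rfl⟩ := (hmema z).1 hz
    obtain ⟨p, q, rfl⟩ := (hmemO α).1 hα
    refine (hmema _).2 ⟨p * x - q * y * C, p * y + q * x * A - q * y * B, ?_⟩
    push_cast
    linear_combination -(q : ℂ) * y * htt
  · obtain ⟨p, q, rfl⟩ := (hmemO z).1 hz
    have hdvd (k : ℤ) : (p : ℂ) + q * t - k ∈ Submodule.span ℤ {(A : ℂ), t} ↔ A ∣ p - k := by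
      rw [hmema]
      constructor
      · rintro ⟨x, y, h⟩
        have h' : ((x * A : ℤ) : ℂ) + y * t = (p - k : ℤ) + q * t := by
          rw [h]
          push_cast
          ring
        exact ⟨x, by rw [← (int_eq_of_add_mul_eq htim h').1, mul_comm]⟩
      · rintro ⟨x, h⟩
        refine ⟨x, q, ?_⟩
        rw [mul_comm, ← h]
        push_cast
        ring
    simp only [hdvd]
    refine ⟨p % A, ⟨Int.emod_nonneg _ hA.ne', Int.emod_lt_of_pos _ hA, Int.dvd_self_sub_emod⟩, ?_⟩
    rintro k ⟨h0, h1, h2⟩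
    rw [← Int.emod_eq_of_lt h0 h1]
    exact Int.modEq_iff_dvd.2 h2
end
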